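/- arXiv:1310.5195 — 3 statements merged into one kernel-verified Lean document; each statement's English description precedes it below -/
import Mathlib

section
/- In the forest gluing setup, the space of compatible tuples S is a K-linear subspace of ∏_{v∈V} W_v of dimension dim_K S = Σ_{v∈V} dim_K W_v − Σ_{e∈E} dim_K F_e. In particular, the dimension of S depends only on the dimensions of the W_v and F_e and the forest G, and not on the choice of the surjections φ_{e,v}. -/
/-- The forest gluing setup: given a vector space `W v` at each vertex of a forest `G`,
a vector space `F e` at each edge, and a surjection `φ e v : W v → F e` for each edge `e`
and each endpoint `v` of `e`, the space of compatible tuples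
`S = { (s_v)_v : φ_{e,u}(s_u) = φ_{e,v}(s_v) for every edge e with endpoints u, v }`
as a submodule of `∏ v, W v`. -/
def compatibleSubmodule {K V : Type*} [Field K] (G : SimpleGraph V)
    (W : V → Type*) [∀ v, AddCommGroup (W v)] [∀ v, Module K (W v)]
    (F : G.edgeSet → Type*) [∀ e, AddCommGroup (F e)] [∀ e, Module K (F e)]
    (φ : ∀ (e : G.edgeSet) (v : V), v ∈ (e : Sym2 V) → (W v →ₗ[K] F e)) :
    Submodule K (∀ v, W v) where
  carrier := {s | ∀ (e : G.edgeSet) (u v : V) (hu : u ∈ (e : Sym2 V))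
      (hv : v ∈ (e : Sym2 V)), φ e u hu (s u) = φ e v hv (s v)}
  add_mem' := by
    intro a b ha hb e u v hu hv
    simp only [Pi.add_apply, map_add, ha e u v hu hv, hb e u v hu hv]
  zero_mem' := by
    intro e u v hu hv
    simp
  smul_mem' := by
    intro c a ha e u v hu hv
    simp only [Pi.smul_apply, map_smul, ha e u v hu hv]

/-- A nonempty acyclic graph with finitely many edges has a vertex with at most one neighbor. -/
theorem SimpleGraph.IsAcyclic.exists_subsingleton_neighborSet {V : Type*} {G : SimpleGraph V}
    [Nonempty V] [Finite G.edgeSet] (hG : G.IsAcyclic) :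
    ∃ v, (G.neighborSet v).Subsingleton := by
  obtain ⟨u, v, p, hp, hmax⟩ := SimpleGraph.Walk.exists_isPath_forall_isPath_length_le_length G
  have eq_snd : ∀ w, G.Adj u w → w = p.snd := fun w hadj ↦ by
    refine hG.eq_snd_of_adj_start hp hadj ?_
    by_contra hw
    have := hmax _ _ _ (hp.cons (h := hadj.symm) hw)
    rw [SimpleGraph.Walk.length_cons] at this
    lia
  exact ⟨u, fun a ha b hb ↦ (eq_snd a ha).trans (eq_snd b hb).symm⟩

section EdgeDifference

variable {K V : Type*} [Field K] {G : SimpleGraph V}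
  {W : V → Type*} [∀ v, AddCommGroup (W v)] [∀ v, Module K (W v)]
  {F : G.edgeSet → Type*} [∀ e, AddCommGroup (F e)] [∀ e, Module K (F e)]
  (φ : ∀ (e : G.edgeSet) (v : V), v ∈ (e : Sym2 V) → (W v →ₗ[K] F e))

/-- The difference of the two images of a tuple in `F e`, for an arbitrary choice of
orientation of each edge `e`. -/
noncomputable def edgeDifference : (∀ v, W v) →ₗ[K] ∀ e, F e :=
  LinearMap.pi fun e ↦
    φ e _ (Sym2.out_fst_mem e.1) ∘ₗ LinearMap.proj _ -
      φ e _ (Sym2.out_snd_mem e.1) ∘ₗ LinearMap.proj _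

theorem edgeDifference_apply (s : ∀ v, W v) (e : G.edgeSet) :
    edgeDifference φ s e =
      φ e _ (Sym2.out_fst_mem e.1) (s _) - φ e _ (Sym2.out_snd_mem e.1) (s _) :=
  rfl

theorem eq_out_fst_or_eq_out_snd {z : Sym2 V} {v : V} (hv : v ∈ z) :
    v = (Quot.out z).1 ∨ v = (Quot.out z).2 := by
  rwa [← Quot.out_eq z, ← Prod.mk.eta (p := Quot.out z), ← Sym2.mk, Sym2.mem_iff] at hv

theorem ker_edgeDifference : LinearMap.ker (edgeDifference φ) = compatibleSubmodule G W F φ := by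
  ext s
  rw [LinearMap.mem_ker, funext_iff]
  refine ⟨fun h e u v hu hv ↦ ?_, fun h e ↦ sub_eq_zero.2 (h e _ _ _ _)⟩
  have he := sub_eq_zero.1 (h e)
  rcases eq_out_fst_or_eq_out_snd hu with rfl | rfl <;>
    rcases eq_out_fst_or_eq_out_snd hv with rfl | rfl
  exacts [rfl, he, he.symm, rfl]

theorem edgeDifference_single_of_notMem [DecidableEq V] {e : G.edgeSet} {v : V}
    (hv : v ∉ (e : Sym2 V)) (x : W v) : edgeDifference φ (Pi.single v x) e = 0 := by
  rw [edgeDifference_apply, Pi.single_eq_of_ne, Pi.single_eq_of_ne, map_zero, map_zero, sub_zero]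
  · exact fun h ↦ hv (h ▸ Sym2.out_snd_mem e.1)
  · exact fun h ↦ hv (h ▸ Sym2.out_fst_mem e.1)

theorem exists_edgeDifference_single_eq [DecidableEq V] {e : G.edgeSet} {v : V}
    (hv : v ∈ (e : Sym2 V)) (hsurj : Function.Surjective (φ e v hv)) (y : F e) :
    ∃ x : W v, edgeDifference φ (Pi.single v x) e = y := by
  have hne : (Quot.out e.1).1 ≠ (Quot.out e.1).2 := by
    have h := e.2
    rw [← Quot.out_eq e.1] at h
    exact G.ne_of_adj h
  rcases eq_out_fst_or_eq_out_snd hv with rfl | rfl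
  · obtain ⟨x, hx⟩ := hsurj y
    refine ⟨x, ?_⟩
    rw [edgeDifference_apply, Pi.single_eq_same, Pi.single_eq_of_ne hne.symm, map_zero, sub_zero,
      hx]
  · obtain ⟨x, hx⟩ := hsurj (-y)
    refine ⟨x, ?_⟩
    rw [edgeDifference_apply, Pi.single_eq_same, Pi.single_eq_of_ne hne, map_zero, zero_sub, hx,
      neg_neg]

theorem exists_edgeDifference_eq_of_subset (hG : G.IsAcyclic)
    (hsurj : ∀ (e : G.edgeSet) (v : V) (hv : v ∈ (e : Sym2 V)), Function.Surjective (φ e v hv))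
    (t : ∀ e, F e) (A : Finset V) :
    ∃ s : ∀ v, W v, ∀ e : G.edgeSet, (∀ v ∈ (e : Sym2 V), v ∈ A) →
      edgeDifference φ s e = t e := by
  classical
  induction A using Finset.strongInduction with
  | H A ih =>
    rcases A.eq_empty_or_nonempty with rfl | hA
    · exact ⟨0, fun e he ↦ absurd (he _ (Sym2.out_fst_mem e.1)) (Finset.notMem_empty _)⟩
    have : Nonempty (A : Set V) := hA.to_subtype
    obtain ⟨⟨v, hvA⟩, hv⟩ := (hG.induce (A : Set V)).exists_subsingleton_neighborSet
    obtain ⟨s, hs⟩ := ih _ (Finset.erase_ssubset hvA)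
    have eq_of_mem : ∀ e e' : G.edgeSet, (∀ u ∈ (e : Sym2 V), u ∈ A) →
        (∀ u ∈ (e' : Sym2 V), u ∈ A) → v ∈ (e : Sym2 V) → v ∈ (e' : Sym2 V) → e = e' := by
      rintro ⟨e, he⟩ ⟨e', he'⟩ heA heA' hve hve'
      obtain ⟨w, rfl⟩ := hve
      obtain ⟨w', rfl⟩ := hve'
      have hw : (⟨w, heA w (Sym2.mem_mk_right v w)⟩ : (A : Set V)) =
          ⟨w', heA' w' (Sym2.mem_mk_right v w')⟩ := hv he he'
      obtain rfl : w = w' := congrArg Subtype.val hw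
      rfl
    have hs' : ∀ x : W v, ∀ e : G.edgeSet, (∀ u ∈ (e : Sym2 V), u ∈ A) → v ∉ (e : Sym2 V) →
        edgeDifference φ (s + Pi.single v x) e = t e := fun x e heA hve ↦ by
      rw [map_add, Pi.add_apply, edgeDifference_single_of_notMem φ hve, add_zero]
      exact hs e fun u hu ↦ Finset.mem_erase.2 ⟨fun h ↦ hve (h ▸ hu), heA u hu⟩
    by_cases h : ∃ e : G.edgeSet, (∀ u ∈ (e : Sym2 V), u ∈ A) ∧ v ∈ (e : Sym2 V)
    · obtain ⟨e₀, he₀A, hve₀⟩ := h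
      obtain ⟨x, hx⟩ := exists_edgeDifference_single_eq φ hve₀ (hsurj e₀ v hve₀)
        (t e₀ - edgeDifference φ s e₀)
      refine ⟨s + Pi.single v x, fun e heA ↦ ?_⟩
      by_cases hve : v ∈ (e : Sym2 V)
      · obtain rfl := eq_of_mem e e₀ heA he₀A hve hve₀
        rw [map_add, Pi.add_apply, hx, add_sub_cancel]
      · exact hs' x e heA hve
    · exact ⟨s + Pi.single v 0, fun e heA ↦ hs' 0 e heA fun hve ↦ h ⟨e, heA, hve⟩⟩

theorem edgeDifference_surjective [Finite V] (hG : G.IsAcyclic)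
    (hsurj : ∀ (e : G.edgeSet) (v : V) (hv : v ∈ (e : Sym2 V)), Function.Surjective (φ e v hv)) :
    Function.Surjective (edgeDifference φ) := fun t ↦ by
  have := Fintype.ofFinite V
  obtain ⟨s, hs⟩ := exists_edgeDifference_eq_of_subset φ hG hsurj t Finset.univ
  exact ⟨s, funext fun e ↦ hs e fun v _ ↦ Finset.mem_univ v⟩

end EdgeDifference

/-- In the forest gluing setup, `dim S = Σ_v dim W_v − Σ_e dim F_e`; in particular the
dimension of `S` is independent of the choice of the surjections `φ`. -/
theorem finrank_compatibleSubmodule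
    {K V : Type*} [Field K] [Fintype V] (G : SimpleGraph V) (hG : G.IsAcyclic)
    [Fintype G.edgeSet]
    (W : V → Type*) [∀ v, AddCommGroup (W v)] [∀ v, Module K (W v)]
    [∀ v, FiniteDimensional K (W v)]
    (F : G.edgeSet → Type*) [∀ e, AddCommGroup (F e)] [∀ e, Module K (F e)]
    [∀ e, FiniteDimensional K (F e)]
    (φ : ∀ (e : G.edgeSet) (v : V), v ∈ (e : Sym2 V) → (W v →ₗ[K] F e))
    (hsurj : ∀ (e : G.edgeSet) (v : V) (hv : v ∈ (e : Sym2 V)),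
      Function.Surjective (φ e v hv)) :
    (Module.finrank K (compatibleSubmodule G W F φ) : ℤ)
      = (∑ v : V, (Module.finrank K (W v) : ℤ))
        - ∑ e : G.edgeSet, (Module.finrank K (F e) : ℤ) := by
  have h := (edgeDifference φ).finrank_range_add_finrank_ker
  rw [LinearMap.range_eq_top.2 (edgeDifference_surjective φ hG hsurj), finrank_top,
    ker_edgeDifference, Module.finrank_pi_fintype, Module.finrank_pi_fintype] at h
  rw [eq_sub_iff_add_eq']
  exact_mod_cast h
end

section
/- In the forest gluing setup, for every vertex v₀ ∈ V the projection S → W_{v₀}, (s_v)_{v∈V} ↦ s_{v₀}, is surjective: every element of W_{v₀} extends to a compatible tuple in S. -/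
/-- Transport of an element along a walk, given a transport along each edge. -/
def SimpleGraph.Walk.transport {V : Type*} {G : SimpleGraph V} {W : V → Type*}
    (step : ∀ u v, G.Adj u v → W u → W v) : ∀ {u v : V}, G.Walk u v → W u → W v
  | _, _, .nil, x => x
  | _, _, .cons h p, x => p.transport step (step _ _ h x)

theorem SimpleGraph.Walk.transport_concat {V : Type*} {G : SimpleGraph V} {W : V → Type*}
    (step : ∀ u v, G.Adj u v → W u → W v) {u v w : V} (p : G.Walk u v) (h : G.Adj v w)
    (x : W u) : (p.concat h).transport step x = step v w h (p.transport step x) := by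
  induction p with
  | nil => rfl
  | cons h' p ih => exact ih h _

/-- In a forest, of two paths from a common vertex to adjacent vertices, one extends the other
by the edge between their endpoints. -/
theorem SimpleGraph.IsAcyclic.eq_concat_or_eq_concat {V : Type*} {G : SimpleGraph V}
    (hG : G.IsAcyclic) {a u v : V} {p : G.Walk a u} {q : G.Walk a v} (hp : p.IsPath)
    (hq : q.IsPath) (h : G.Adj u v) : q = p.concat h ∨ p = q.concat h.symm := by
  by_cases hu : u ∈ q.support
  · exact .inl (hG.path_concat hp hq h hu)
  · exact .inr (hG.path_concat hq hp h.symm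
      (hG.mem_support_of_ne_mem_support_of_adj_of_isPath hp hq h hu))

/-- If elements can be transported along edges of a forest so that the results are related by a
symmetric relation, then any element at a vertex extends to a family related along all edges. -/
theorem SimpleGraph.IsAcyclic.exists_extension {V : Type*} {G : SimpleGraph V}
    (hG : G.IsAcyclic) {W : V → Type*} (R : ∀ u v, G.Adj u v → W u → W v → Prop)
    (hR : ∀ u v (h : G.Adj u v) x y, R u v h x y → R v u h.symm y x)
    (hstep : ∀ u v (h : G.Adj u v) x, ∃ y, R u v h x y)
    (z : ∀ v, W v) (hz : ∀ u v (h : G.Adj u v), R u v h (z u) (z v)) (a : V) (w : W a) :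
    ∃ s : ∀ v, W v, (∀ u v (h : G.Adj u v), R u v h (s u) (s v)) ∧ s a = w := by
  classical
  choose step hstep using hstep
  have hpath : ∀ v, G.Reachable a v → ∃ p : G.Walk a v, p.IsPath := fun v h ↦
    h.exists_isPath
  choose P hP using hpath
  refine ⟨fun v ↦ if h : G.Reachable a v then (P v h).transport step w else z v, ?_, ?_⟩
  · intro u v h
    by_cases hu : G.Reachable a u
    · have hv : G.Reachable a v := hu.trans h.reachable
      simp only [hu, hv, dite_true]
      rcases hG.eq_concat_or_eq_concat (hP u hu) (hP v hv) h with e | e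
      · rw [e, Walk.transport_concat]
        exact hstep _ _ _ _
      · rw [e, Walk.transport_concat]
        exact hR _ _ _ _ _ (hstep _ _ _ _)
    · have hv : ¬ G.Reachable a v := fun hv ↦ hu (hv.trans h.symm.reachable)
      simp only [hu, hv, dite_false]
      exact hz u v h
  · have ha : G.Reachable a a := .refl a
    have hnil : P a ha = .nil := (Walk.isPath_iff_nil.mp (hP a ha)).eq_nil
    simp only [ha, dite_true, hnil, Walk.transport]

/-- In the forest gluing setup, for every vertex `v₀` the projection `S → W v₀` is
surjective: every element of `W v₀` extends to a compatible tuple. -/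
theorem compatibleSubmodule_proj_surjective
    {K V : Type*} [Field K] [Fintype V] (G : SimpleGraph V) (hG : G.IsAcyclic)
    [Fintype G.edgeSet]
    (W : V → Type*) [∀ v, AddCommGroup (W v)] [∀ v, Module K (W v)]
    [∀ v, FiniteDimensional K (W v)]
    (F : G.edgeSet → Type*) [∀ e, AddCommGroup (F e)] [∀ e, Module K (F e)]
    [∀ e, FiniteDimensional K (F e)]
    (φ : ∀ (e : G.edgeSet) (v : V), v ∈ (e : Sym2 V) → (W v →ₗ[K] F e))
    (hsurj : ∀ (e : G.edgeSet) (v : V) (hv : v ∈ (e : Sym2 V)),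
      Function.Surjective (φ e v hv))
    (v₀ : V) (w : W v₀) :
    ∃ s ∈ compatibleSubmodule G W F φ, s v₀ = w := by
  obtain ⟨s, hs, hw⟩ := hG.exists_extension
    (fun u v h x y ↦ φ ⟨s(u, v), h⟩ u (Sym2.mem_mk_left u v) x =
      φ ⟨s(u, v), h⟩ v (Sym2.mem_mk_right u v) y)
    (fun u v h x y hxy ↦ by
      have swap : ∀ (e e' : G.edgeSet) (_ : e = e') (hu : u ∈ (e : Sym2 V))
          (hv : v ∈ (e : Sym2 V)) (hu' : u ∈ (e' : Sym2 V)) (hv' : v ∈ (e' : Sym2 V)),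
          φ e u hu x = φ e v hv y → φ e' v hv' y = φ e' u hu' x := by
        rintro e _ rfl _ _ _ _ he
        exact he.symm
      exact swap _ _ (Subtype.ext Sym2.eq_swap) _ _ _ _ hxy)
    (fun u v h x ↦ (hsurj _ v _ _).imp fun _ hy ↦ hy.symm)
    0 (fun u v h ↦ by simp) v₀ w
  refine ⟨s, ?_, hw⟩
  rintro ⟨e, he⟩ u v hu hv
  by_cases huv : u = v
  · subst huv
    rfl
  · obtain rfl := (Sym2.mem_and_mem_iff huv).mp ⟨hu, hv⟩
    exact hs u v he
end

section
/- In the forest gluing setup, assume moreover that there are a natural number r and natural numbers a_v (v ∈ V) such that dim_K F_e = r for every edge e ∈ E and dim_K W_v = r + a_v for every vertex v ∈ V. Then dim_K S = r·c + Σ_{v∈V} a_v, where c is the number of connected components of G. -/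
namespace SimpleGraph

/-- A finite forest with at least one edge has a vertex of degree one. -/
theorem IsAcyclic.exists_adj_forall_adj_eq {V : Type*} [Finite V] {G : SimpleGraph V}
    (hG : G.IsAcyclic) (hne : G ≠ ⊥) :
    ∃ v w, G.Adj v w ∧ ∀ w', G.Adj v w' → w' = w := by
  obtain ⟨a, b, hab⟩ := ne_bot_iff_exists_adj.mp hne
  have : Nonempty V := ⟨a⟩
  obtain ⟨u, v, p, hp, hmax⟩ := Walk.exists_isPath_forall_isPath_length_le_length G
  have hlen := hmax a b (Path.singleton hab) (Path.singleton hab).isPath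
  have hnil : ¬ p.Nil := by
    intro h
    simp [Walk.length_eq_zero_iff.mpr h, Path.singleton] at hlen
  refine ⟨u, p.snd, p.adj_snd hnil, fun w hw ↦ hG.eq_snd_of_adj_start hp hw ?_⟩
  by_contra hmem
  have := hmax _ _ (Walk.cons hw.symm p) (hp.cons hmem)
  simp at this

/-- Every nonempty finite set of edges of a forest has an edge with an endpoint that belongs to
no other edge of the set. -/
theorem IsAcyclic.exists_mem_edge_unique {V : Type*} [Finite V] {G : SimpleGraph V}
    (hG : G.IsAcyclic) {A : Finset G.edgeSet} (hA : A.Nonempty) :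
    ∃ e ∈ A, ∃ v ∈ (e : Sym2 V), ∀ e' ∈ A, v ∈ (e' : Sym2 V) → e' = e := by
  let H := fromEdgeSet (Subtype.val '' (A : Set G.edgeSet))
  have hadj {v w : V} : H.Adj v w ↔ ∃ e ∈ A, (e : Sym2 V) = s(v, w) := by
    simp only [H, fromEdgeSet_adj, Set.mem_image, Finset.mem_coe, and_iff_left_iff_imp]
    rintro ⟨e, -, he⟩
    exact G.ne_of_adj (G.mem_edgeSet.mp (he ▸ e.2))
  have hle : H ≤ G := fun v w h ↦ by
    obtain ⟨e, -, he⟩ := hadj.mp h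
    exact G.mem_edgeSet.mp (he ▸ e.2)
  have hne : H ≠ ⊥ := by
    obtain ⟨⟨e, he⟩, heA⟩ := hA
    induction e with
    | h a b => exact ne_bot_iff_exists_adj.mpr ⟨a, b, hadj.mpr ⟨_, heA, rfl⟩⟩
  obtain ⟨v, w, hvw, huniq⟩ := (hG.anti hle).exists_adj_forall_adj_eq hne
  obtain ⟨e, heA, he⟩ := hadj.mp hvw
  refine ⟨e, heA, v, he ▸ Sym2.mem_mk_left v w, fun e' he' hv ↦ Subtype.ext ?_⟩
  obtain ⟨w', hw'⟩ := hv
  rw [he, hw', huniq w' (hadj.mpr ⟨e', he', hw'⟩)]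

end SimpleGraph

section Coboundary

variable {K V : Type*} [Field K] {G : SimpleGraph V}
  {W : V → Type*} [∀ v, AddCommGroup (W v)] [∀ v, Module K (W v)]
  {F : G.edgeSet → Type*} [∀ e, AddCommGroup (F e)] [∀ e, Module K (F e)]
  (φ : ∀ (e : G.edgeSet) (v : V), v ∈ (e : Sym2 V) → (W v →ₗ[K] F e))

/-- The map `∏ v, W v → ∏ e, F e` whose component at an edge is the difference of the images of
the values at its two endpoints, in an arbitrary order. -/
noncomputable def coboundary : (∀ v, W v) →ₗ[K] ∀ e, F e :=
  LinearMap.pi fun e ↦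
    φ e _ (Sym2.out_fst_mem e.1) ∘ₗ LinearMap.proj _ -
      φ e _ (Sym2.out_snd_mem e.1) ∘ₗ LinearMap.proj _

theorem coboundary_apply (s : ∀ v, W v) (e : G.edgeSet) :
    coboundary φ s e = φ e _ (Sym2.out_fst_mem e.1) (s _) - φ e _ (Sym2.out_snd_mem e.1) (s _) :=
  rfl

theorem ker_coboundary : LinearMap.ker (coboundary φ) = compatibleSubmodule G W F φ := by
  ext s
  rw [LinearMap.mem_ker]
  refine ⟨fun h e ↦ ?_, fun h ↦ funext fun e ↦ sub_eq_zero.mpr (h e _ _ _ _)⟩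
  have he := sub_eq_zero.mp (congrFun h e)
  have key (u : V) (hu : u ∈ (e : Sym2 V)) :
      φ e u hu (s u) = φ e _ (Sym2.out_fst_mem e.1) (s _) := by
    have hu' := hu
    rw [← Quot.out_eq (e : Sym2 V)] at hu'
    obtain rfl | rfl := Sym2.mem_iff.mp hu'
    exacts [rfl, he.symm]
  exact fun u v hu hv ↦ (key u hu).trans (key v hv).symm

theorem coboundary_surjective [Finite V] (hG : G.IsAcyclic)
    (hsurj : ∀ (e : G.edgeSet) (v : V) (hv : v ∈ (e : Sym2 V)), Function.Surjective (φ e v hv)) :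
    Function.Surjective (coboundary φ) := by
  classical
  have := Fintype.ofFinite G.edgeSet
  intro t
  suffices h : ∀ A : Finset G.edgeSet, ∃ s, ∀ e ∈ A, coboundary φ s e = t e by
    obtain ⟨s, hs⟩ := h Finset.univ
    exact ⟨s, funext fun e ↦ hs e (Finset.mem_univ e)⟩
  intro A
  induction A using Finset.strongInduction with
  | H A ih =>
    obtain rfl | hA := A.eq_empty_or_nonempty
    · exact ⟨0, by simp⟩
    obtain ⟨e, heA, v, hv, huniq⟩ := hG.exists_mem_edge_unique hA
    obtain ⟨s, hs⟩ := ih _ (Finset.erase_ssubset heA)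
    have hother (x : W v) (e' : G.edgeSet) (he' : e' ∈ A) (hne : e' ≠ e) :
        coboundary φ (Function.update s v x) e' = t e' := by
      have hv' : v ∉ (e' : Sym2 V) := fun h ↦ hne (huniq e' he' h)
      rw [← hs e' (Finset.mem_erase.mpr ⟨hne, he'⟩), coboundary_apply, coboundary_apply,
        Function.update_of_ne (fun h : (Quot.out e'.1).1 = v ↦ hv' (h ▸ Sym2.out_fst_mem e'.1)),
        Function.update_of_ne (fun h : (Quot.out e'.1).2 = v ↦ hv' (h ▸ Sym2.out_snd_mem e'.1))]
    suffices ∃ x : W v, coboundary φ (Function.update s v x) e = t e by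
      obtain ⟨x, hx⟩ := this
      refine ⟨Function.update s v x, fun e' he' ↦ ?_⟩
      obtain rfl | hne := eq_or_ne e' e
      exacts [hx, hother x e' he' hne]
    have hends : (Quot.out (e : Sym2 V)).1 ≠ (Quot.out (e : Sym2 V)).2 := by
      have he := e.2
      rw [← Quot.out_eq (e : Sym2 V)] at he
      exact G.ne_of_adj (G.mem_edgeSet.mp he)
    have hv' : v = (Quot.out (e : Sym2 V)).1 ∨ v = (Quot.out (e : Sym2 V)).2 := by
      rwa [← Sym2.mem_iff, Sym2.mk, Quot.out_eq]
    obtain rfl | rfl := hv'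
    · obtain ⟨x, hx⟩ := hsurj e _ hv (t e + φ e _ (Sym2.out_snd_mem e.1) (s _))
      refine ⟨x, ?_⟩
      rw [coboundary_apply, Function.update_self, Function.update_of_ne hends.symm, hx,
        add_sub_cancel_right]
    · obtain ⟨x, hx⟩ := hsurj e _ hv (φ e _ (Sym2.out_fst_mem e.1) (s _) - t e)
      refine ⟨x, ?_⟩
      rw [coboundary_apply, Function.update_self, Function.update_of_ne hends, hx,
        sub_sub_cancel]

/-- In a finite forest, the edge conditions cutting out the compatible tuples are independent. -/
theorem finrank_compatibleSubmodule_add_sum [Fintype V] [Fintype G.edgeSet] (hG : G.IsAcyclic)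
    [∀ v, FiniteDimensional K (W v)] [∀ e, FiniteDimensional K (F e)]
    (hsurj : ∀ (e : G.edgeSet) (v : V) (hv : v ∈ (e : Sym2 V)), Function.Surjective (φ e v hv)) :
    Module.finrank K (compatibleSubmodule G W F φ) + ∑ e, Module.finrank K (F e) =
      ∑ v, Module.finrank K (W v) := by
  have h := LinearMap.finrank_range_add_finrank_ker (coboundary φ)
  rwa [LinearMap.range_eq_top.mpr (coboundary_surjective φ hG hsurj), finrank_top,
    ker_coboundary, Module.finrank_pi_fintype, Module.finrank_pi_fintype, add_comm] at h

end Coboundary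

/-- For constant coefficients, compatible tuples are functions on the connected components. -/
noncomputable def compatibleSubmoduleConstEquiv (K : Type*) {V : Type*} [Field K]
    (G : SimpleGraph V) :
    (G.ConnectedComponent → K) ≃ₗ[K]
      compatibleSubmodule (K := K) G (fun _ ↦ K) (fun _ ↦ K) (fun _ _ _ ↦ LinearMap.id) :=
  LinearEquiv.ofBijective
    ((LinearMap.funLeft K K G.connectedComponentMk).codRestrict
      (compatibleSubmodule G (fun _ ↦ K) (fun _ ↦ K) fun _ _ _ ↦ LinearMap.id)
      fun f e u v hu hv ↦ by
        obtain rfl | hne := eq_or_ne u v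
        · rfl
        have hadj : G.Adj u v := by
          rw [← G.mem_edgeSet, ← (Sym2.mem_and_mem_iff hne).mp ⟨hu, hv⟩]
          exact e.2
        exact congrArg f (SimpleGraph.ConnectedComponent.sound hadj.reachable)) <| by
    constructor
    · intro f g h
      funext c
      induction c using SimpleGraph.ConnectedComponent.ind with
      | h v => exact congrFun (congrArg Subtype.val h) v
    · rintro ⟨s, hs⟩
      refine ⟨SimpleGraph.ConnectedComponent.lift s fun u v p _ ↦ ?_, rfl⟩
      induction p with
      | nil => rfl
      | cons h p ih =>
        rename_i hp
        exact (hs ⟨s(_, _), h⟩ _ _ (Sym2.mem_mk_left _ _) (Sym2.mem_mk_right _ _)).trans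
          (ih hp.of_cons)

/-- In a finite forest, components and edges together are equinumerous with vertices. -/
theorem SimpleGraph.IsAcyclic.card_connectedComponent_add_card_edgeSet {V : Type*} [Fintype V]
    {G : SimpleGraph V} [Fintype G.edgeSet] [Fintype G.ConnectedComponent] (hG : G.IsAcyclic) :
    Fintype.card G.ConnectedComponent + Fintype.card G.edgeSet = Fintype.card V := by
  have h := finrank_compatibleSubmodule_add_sum (K := ℚ) (G := G) (W := fun _ ↦ ℚ)
    (F := fun _ ↦ ℚ) (fun _ _ _ ↦ LinearMap.id) hG fun _ _ _ ↦ Function.surjective_id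
  rw [← (compatibleSubmoduleConstEquiv ℚ G).finrank_eq] at h
  simpa using h

/-- In the forest gluing setup, if every `F e` has dimension `r` and
`dim W v = r + a v`, then `dim S = r·c + Σ_v a_v`, where `c` is the number of
connected components of the forest `G`. -/
theorem finrank_compatibleSubmodule_of_rank
    {K V : Type*} [Field K] [Fintype V] (G : SimpleGraph V) (hG : G.IsAcyclic)
    [Fintype G.edgeSet] [Fintype G.ConnectedComponent]
    (W : V → Type*) [∀ v, AddCommGroup (W v)] [∀ v, Module K (W v)]
    [∀ v, FiniteDimensional K (W v)]
    (F : G.edgeSet → Type*) [∀ e, AddCommGroup (F e)] [∀ e, Module K (F e)]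
    [∀ e, FiniteDimensional K (F e)]
    (φ : ∀ (e : G.edgeSet) (v : V), v ∈ (e : Sym2 V) → (W v →ₗ[K] F e))
    (hsurj : ∀ (e : G.edgeSet) (v : V) (hv : v ∈ (e : Sym2 V)),
      Function.Surjective (φ e v hv))
    (r : ℕ) (a : V → ℕ)
    (hF : ∀ e : G.edgeSet, Module.finrank K (F e) = r)
    (hW : ∀ v : V, Module.finrank K (W v) = r + a v) :
    Module.finrank K (compatibleSubmodule G W F φ)
      = r * Fintype.card G.ConnectedComponent + ∑ v : V, a v := by
  have h := finrank_compatibleSubmodule_add_sum φ hG hsurj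
  simp only [hF, hW, Finset.sum_add_distrib, Finset.sum_const, Finset.card_univ, smul_eq_mul,
    ← hG.card_connectedComponent_add_card_edgeSet] at h
  linarith
end
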